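/- For all non-negative integers m and n, the q-super Catalan number [2m]!·[2n]! / ([m]!·[n]!·[m+n]!) is a polynomial in q with non-negative integer coefficients. -/

import Mathlib

noncomputable def qfact (k : ℕ) : Polynomial ℤ :=
  ∏ i ∈ Finset.range k, ∑ j ∈ Finset.range (i + 1), Polynomial.X ^ j

open Polynomial Finset

/-- Integer polynomials whose coefficients are all natural numbers. -/
noncomputable def nonnegPolys : Subsemiring ℤ[X] :=
  (mapRingHom (Nat.castRingHom ℤ)).rangeS

lemma coeff_nonneg_of_mem_nonnegPolys {P : ℤ[X]} (hP : P ∈ nonnegPolys) (i : ℕ) :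
    0 ≤ P.coeff i := by
  obtain ⟨R, rfl⟩ := hP
  simp

lemma X_pow_mem_nonnegPolys (e : ℕ) : (X : ℤ[X]) ^ e ∈ nonnegPolys :=
  pow_mem (RingHom.mem_rangeS.2 ⟨X, by simp⟩) e

/-- The Gaussian binomial coefficients, defined by the `q`-Pascal recursion. -/
noncomputable def gaussBinom : ℕ → ℕ → ℤ[X]
  | _, 0 => 1
  | 0, _ + 1 => 0
  | n + 1, k + 1 => gaussBinom n k + X ^ (k + 1) * gaussBinom n (k + 1)

@[simp]
lemma gaussBinom_zero_right (n : ℕ) : gaussBinom n 0 = 1 := by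
  cases n <;> simp [gaussBinom]

@[simp]
lemma gaussBinom_zero_succ (k : ℕ) : gaussBinom 0 (k + 1) = 0 := by
  simp [gaussBinom]

lemma gaussBinom_succ_succ (n k : ℕ) :
    gaussBinom (n + 1) (k + 1) = gaussBinom n k + X ^ (k + 1) * gaussBinom n (k + 1) := by
  simp [gaussBinom]

lemma gaussBinom_eq_zero_of_lt {n k : ℕ} (h : n < k) : gaussBinom n k = 0 := by
  induction n generalizing k with
  | zero => obtain ⟨k, rfl⟩ := Nat.exists_eq_succ_of_ne_zero h.ne'; simp
  | succ n ih =>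
    obtain ⟨k, rfl⟩ := Nat.exists_eq_succ_of_ne_zero (Nat.ne_zero_of_lt h)
    rw [Nat.succ_eq_add_one, gaussBinom_succ_succ, ih (by omega), ih (by omega)]
    simp

lemma gaussBinom_self (n : ℕ) : gaussBinom n n = 1 := by
  induction n with
  | zero => simp
  | succ n ih => rw [gaussBinom_succ_succ, ih, gaussBinom_eq_zero_of_lt n.lt_succ_self]; simp

lemma gaussBinom_mem_nonnegPolys (n k : ℕ) : gaussBinom n k ∈ nonnegPolys := by
  induction n generalizing k with
  | zero => cases k <;> simp [one_mem, zero_mem]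
  | succ n ih =>
    cases k with
    | zero => simp [one_mem]
    | succ k =>
      rw [gaussBinom_succ_succ]
      exact add_mem (ih k) (mul_mem (X_pow_mem_nonnegPolys _) (ih _))

@[simp]
lemma qfact_zero : qfact 0 = 1 := by simp [qfact]

lemma qfact_succ (k : ℕ) : qfact (k + 1) = qfact k * ∑ j ∈ range (k + 1), X ^ j :=
  prod_range_succ _ _

lemma qfact_ne_zero (k : ℕ) : qfact k ≠ 0 := by
  intro h
  have h1 : (qfact k).eval 1 = 0 := by rw [h, eval_zero]
  simp only [qfact, eval_prod, eval_finsetSum, eval_pow, eval_X, one_pow, sum_const, card_range,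
    prod_eq_zero_iff] at h1
  obtain ⟨i, -, hi⟩ := h1
  simp at hi
  omega

lemma gaussBinom_mul_qfact (a b : ℕ) :
    gaussBinom (a + b) a * (qfact a * qfact b) = qfact (a + b) := by
  induction h : a + b generalizing a b with
  | zero =>
    obtain ⟨rfl, rfl⟩ : a = 0 ∧ b = 0 := by omega
    simp
  | succ n ih =>
    rcases a with _ | a
    · obtain rfl : b = n + 1 := by omega
      simp
    rcases b with _ | b
    · obtain rfl : a = n := by omega
      simp [gaussBinom_self]
    · have h1 := ih a (b + 1) (by omega)
      have h2 := ih (a + 1) b (by omega)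
      obtain rfl : n = a + 1 + b := by omega
      rw [gaussBinom_succ_succ, qfact_succ (a + 1 + b)]
      have hs : ∑ j ∈ range (a + 1 + b + 1), (X : ℤ[X]) ^ j =
          ∑ j ∈ range (a + 1), X ^ j + X ^ (a + 1) * ∑ j ∈ range (b + 1), X ^ j := by
        rw [add_assoc, sum_range_add, mul_sum]
        simp [pow_add]
      rw [hs]
      rw [qfact_succ b] at h1 ⊢
      rw [qfact_succ a] at h2 ⊢
      linear_combination (∑ j ∈ range (a + 1), (X : ℤ[X]) ^ j) * h1 +
        X ^ (a + 1) * (∑ j ∈ range (b + 1), (X : ℤ[X]) ^ j) * h2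

/-- The `q`-Chu–Vandermonde identity. -/
lemma gaussBinom_add (m n k : ℕ) :
    gaussBinom (m + n) k =
      ∑ x ∈ antidiagonal k, gaussBinom m x.1 * gaussBinom n x.2 * X ^ (x.2 * (m - x.1)) := by
  induction m generalizing k with
  | zero =>
    cases k with
    | zero => simp
    | succ k => simp [Nat.sum_antidiagonal_succ]
  | succ m ih =>
    cases k with
    | zero => simp
    | succ k =>
      rw [Nat.add_right_comm, gaussBinom_succ_succ, ih k, ih (k + 1),
        Nat.sum_antidiagonal_succ, Nat.sum_antidiagonal_succ, mul_add, add_left_comm, mul_sum,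
        ← sum_add_distrib]
      congr 1
      · simp only [gaussBinom_zero_right, Nat.sub_zero]
        ring
      · refine sum_congr rfl fun x hx => ?_
        obtain ⟨i, j⟩ := x
        obtain rfl : i + j = k := mem_antidiagonal.1 hx
        simp only [gaussBinom_succ_succ, Nat.add_sub_add_right]
        rcases lt_or_ge m (i + 1) with h | h
        · simp [gaussBinom_eq_zero_of_lt h]
        · obtain ⟨d, rfl⟩ := Nat.exists_eq_add_of_le h
          rw [Nat.add_sub_cancel_left, show i + 1 + d - i = d + 1 by omega]
          ring

/-- One term of the expansion of the super Catalan number `(m, m + 2k + a + b)` in terms of the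
super Catalan number `(m, k)`. -/
lemma qSuperCatalan_term (m k a b : ℕ) {P : ℤ[X]}
    (hP : qfact m * qfact k * qfact (m + k) * P = qfact (2 * m) * qfact (2 * k)) :
    qfact (m + (2 * k + (a + b))) * qfact m *
        (gaussBinom (2 * k + (a + b)) (2 * k) * gaussBinom (a + b) a * P) =
      qfact (2 * m) * qfact (2 * k + (a + b)) *
        (gaussBinom (k + a + (b + (m + k))) (k + a) * gaussBinom (k + a) k *
          gaussBinom (b + (m + k)) b) := by
  have h1 := gaussBinom_mul_qfact (2 * k) (a + b)
  have h2 := gaussBinom_mul_qfact a b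
  have h3 := gaussBinom_mul_qfact (k + a) (b + (m + k))
  have h4 := gaussBinom_mul_qfact k a
  have h5 := gaussBinom_mul_qfact b (m + k)
  have hne : qfact (2 * k) * qfact k * qfact (m + k) * qfact a * qfact b ≠ 0 := by
    simp [qfact_ne_zero]
  rw [show m + (2 * k + (a + b)) = k + a + (b + (m + k)) by omega]
  rw [← h5, ← h4] at h3
  rw [← h2] at h1
  refine mul_right_cancel₀ hne ?_
  rw [← h3, ← h1]
  generalize gaussBinom (k + a + (b + (m + k))) (k + a) = A at *
  linear_combination (A * gaussBinom (k + a) k * qfact k * qfact a * gaussBinom (b + (m + k)) b *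
    qfact b * qfact (m + k) * gaussBinom (2 * k + (a + b)) (2 * k) * gaussBinom (a + b) a *
    qfact a * qfact b * qfact (2 * k)) * hP

/-- If each `d * f x` is a multiple of `c` with cofactor in `nonnegPolys`, then so is
`d * ∑ x ∈ s, f x`. -/
lemma exists_mem_nonnegPolys_mul_sum {ι : Type*} (s : Finset ι) (f : ι → ℤ[X]) (c d : ℤ[X])
    (h : ∀ x ∈ s, ∃ R ∈ nonnegPolys, c * R = d * f x) :
    ∃ R ∈ nonnegPolys, c * R = d * ∑ x ∈ s, f x := by
  choose! R hR hRf using h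
  refine ⟨∑ x ∈ s, R x, sum_mem hR, ?_⟩
  rw [mul_sum, mul_sum]
  exact sum_congr rfl hRf

lemma exists_qSuperCatalan_of_half (m p : ℕ)
    (ih : ∀ k, 2 * k ≤ p → ∃ P ∈ nonnegPolys,
      qfact m * qfact k * qfact (m + k) * P = qfact (2 * m) * qfact (2 * k)) :
    ∃ P ∈ nonnegPolys, qfact m * qfact (m + p) * qfact (m + (m + p)) * P =
      qfact (2 * m) * qfact (2 * (m + p)) := by
  suffices h : ∃ R ∈ nonnegPolys, qfact (m + p) * qfact m * R =
      qfact (2 * m) * qfact p * gaussBinom (m + p + (m + p)) p by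
    obtain ⟨R, hR, h⟩ := h
    refine ⟨R, hR, ?_⟩
    have hb := gaussBinom_mul_qfact p (m + (m + p))
    rw [show p + (m + (m + p)) = m + p + (m + p) by omega] at hb
    rw [two_mul (m + p), ← hb]
    linear_combination qfact (m + (m + p)) * h
  rw [gaussBinom_add]
  refine exists_mem_nonnegPolys_mul_sum _ _ _ _ fun ⟨i, l⟩ hil => ?_
  obtain rfl : i + l = p := mem_antidiagonal.1 hil
  have hl : gaussBinom (m + (i + l)) l = gaussBinom (i + (m + l)) l := by
    rw [Nat.add_left_comm]
  simp only [hl, gaussBinom_add i (m + l) l, mul_sum, sum_mul]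
  rw [← mul_sum]
  refine exists_mem_nonnegPolys_mul_sum _ _ _ _ fun ⟨k, b⟩ hkb => ?_
  obtain rfl : k + b = l := mem_antidiagonal.1 hkb
  rcases lt_or_ge i k with hik | hik
  · exact ⟨0, zero_mem _, by simp [gaussBinom_eq_zero_of_lt hik]⟩
  obtain ⟨a, rfl⟩ := Nat.exists_eq_add_of_le hik
  obtain ⟨P, hP, hPm⟩ := ih k (by omega)
  have ht := qSuperCatalan_term m k a b hPm
  have e2 : k + a + (k + b) = 2 * k + (a + b) := by omega
  have e3 : m + (k + b) = b + (m + k) := by omega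
  have e4 : m + (2 * k + (a + b)) = k + a + (b + (m + k)) := by omega
  refine ⟨gaussBinom (2 * k + (a + b)) (2 * k) * gaussBinom (a + b) a * P *
    (X ^ (b * (k + a - k)) * X ^ ((k + b) * (m + (k + a + (k + b)) - (k + a)))),
    mul_mem (mul_mem (mul_mem (gaussBinom_mem_nonnegPolys _ _) (gaussBinom_mem_nonnegPolys _ _)) hP)
      (mul_mem (X_pow_mem_nonnegPolys _) (X_pow_mem_nonnegPolys _)), ?_⟩
  simp only [e2, e3] at ht ⊢
  rw [← mul_assoc, ht, e4]
  ring

lemma exists_qSuperCatalan (m n : ℕ) :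
    ∃ P ∈ nonnegPolys, qfact m * qfact n * qfact (m + n) * P = qfact (2 * m) * qfact (2 * n) := by
  induction h : m + n using Nat.strong_induction_on generalizing m n with
  | _ s ih =>
    subst h
    wlog hmn : m ≤ n generalizing m n
    · obtain ⟨P, hP, hPm⟩ := this n m (fun s hs => ih s (by omega)) (by omega)
      refine ⟨P, hP, ?_⟩
      rw [add_comm m n]
      linear_combination hPm
    rcases Nat.eq_zero_or_pos n with rfl | hn
    · obtain rfl : m = 0 := by omega
      exact ⟨1, one_mem _, by simp⟩
    obtain ⟨p, rfl⟩ := Nat.exists_eq_add_of_le hmn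
    exact exists_qSuperCatalan_of_half m p fun k hk => ih (m + k) (by omega) m k rfl

theorem qSuperCatalan_nonneg_coeffs (m n : ℕ) :
    ∃ P : Polynomial ℤ, qfact m * qfact n * qfact (m + n) * P = qfact (2*m) * qfact (2*n) ∧
      ∀ i, 0 ≤ P.coeff i := by
  obtain ⟨P, hP, h⟩ := exists_qSuperCatalan m n
  exact ⟨P, h, coeff_nonneg_of_mem_nonnegPolys hP⟩
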